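/- arXiv:math/0504299 — 2 statements merged into one kernel-verified Lean document; each statement's English description precedes it below -/
import Mathlib

section
/- Let n ∈ ℕ and let F : Δ_n(OXYZ) → ℝ be a polarized function on the tetrahedral grid Δ_n(OXYZ). If the restrictions of F to the ground (face z = 0) and to the front wall (face y = 0) are discrete concave, then the restrictions of F to the shadow wall (face x = 0) and to the slope wall (face x+y+z = n) are also discrete concave. -/
/-- Points of the three-dimensional lattice. -/
abbrev V3 : Type := ℤ × ℤ × ℤ

def e1 : V3 := (1, 0, 0)
def e2 : V3 := (0, 1, 0)
def e3 : V3 := (0, 0, 1)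

/-- The unimodular set `D = {e₁, e₂, e₃, e₁−e₂, e₁−e₃, e₂−e₃}`. -/
def Dset : Set V3 := {e1, e2, e3, e1 - e2, e1 - e3, e2 - e3}

/-- The set `±D = D ∪ (−D)`. -/
def pmD : Set V3 := {v | v ∈ Dset ∨ -v ∈ Dset}

/-- `F` is polarized on `S`: for every primitive octahedron contained in `S`, the sum of the
values at the ends of the main diagonal (direction `(−1,1,1)`) equals the maximum of the sums
at the ends of the two other diagonals. -/
def IsPolarizedOn (S : Set V3) (F : V3 → ℝ) : Prop :=
  ∀ p : V3, p ∈ S → p + (-1, 1, 1) ∈ S → p + (0, 0, 1) ∈ S → p + (-1, 1, 0) ∈ S →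
    p + (0, 1, 0) ∈ S → p + (-1, 0, 1) ∈ S →
    F p + F (p + (-1, 1, 1)) =
      max (F (p + (0, 0, 1)) + F (p + (-1, 1, 0))) (F (p + (0, 1, 0)) + F (p + (-1, 0, 1)))

/-- `(q, q+a, q+b, q+a+b)` is a primitive rhombus: `a, b ∈ ±D`, `a ≠ ±b`, and one of the
diagonal directions `a+b`, `a−b` lies in `±D` (that diagonal is the short one). -/
def IsPrimRhombus (a b : V3) : Prop :=
  a ∈ pmD ∧ b ∈ pmD ∧ a ≠ b ∧ a ≠ -b ∧ (a + b ∈ pmD ∨ a - b ∈ pmD)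

/-- The rhombus inequalities associated to the primitive rhombus `(q, q+a, q+b, q+a+b)`:
the sum at the short diagonal is at least the sum at the long diagonal. -/
def RhombusIneq (F : V3 → ℝ) (q a b : V3) : Prop :=
  (a + b ∈ pmD → F q + F (q + a + b) ≥ F (q + a) + F (q + b)) ∧
  (a - b ∈ pmD → F (q + a) + F (q + b) ≥ F q + F (q + a + b))

/-- All rhombus inequalities for primitive rhombi whose four points lie in `S` hold. -/
def DiscreteConcaveOn (S : Set V3) (F : V3 → ℝ) : Prop :=
  ∀ q a b : V3, IsPrimRhombus a b → q ∈ S → q + a ∈ S → q + b ∈ S → q + a + b ∈ S →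
    RhombusIneq F q a b

/-- `F` is polarized discrete concave on `S`. -/
def PDCOn (S : Set V3) (F : V3 → ℝ) : Prop :=
  IsPolarizedOn S F ∧ DiscreteConcaveOn S F

/-- The tetrahedral grid `Δ_n(OXYZ)`. -/
def Tet (n : ℕ) : Set V3 :=
  {v | 0 ≤ v.1 ∧ 0 ≤ v.2.1 ∧ 0 ≤ v.2.2 ∧ v.1 + v.2.1 + v.2.2 ≤ (n : ℤ)}

/-- The ground face `z = 0` of `Δ_n(OXYZ)`. -/
def ground (n : ℕ) : Set V3 := {v | v ∈ Tet n ∧ v.2.2 = 0}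

/-- The front wall `y = 0` of `Δ_n(OXYZ)`. -/
def frontWall (n : ℕ) : Set V3 := {v | v ∈ Tet n ∧ v.2.1 = 0}

/-- The shadow wall `x = 0` of `Δ_n(OXYZ)`. -/
def shadowWall (n : ℕ) : Set V3 := {v | v ∈ Tet n ∧ v.1 = 0}

/-- The slope wall `x + y + z = n` of `Δ_n(OXYZ)`. -/
def slopeWall (n : ℕ) : Set V3 := {v | v ∈ Tet n ∧ v.1 + v.2.1 + v.2.2 = (n : ℤ)}

/-- The family `R(d)` of rhombus inequalities on `S` for rhombi whose short diagonal has
direction `±d`. -/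
def FaceR (S : Set V3) (F : V3 → ℝ) (d : V3) : Prop :=
  ∀ q a b : V3, IsPrimRhombus a b → q ∈ S → q + a ∈ S → q + b ∈ S → q + a + b ∈ S →
    ((a + b = d ∨ a + b = -d) → F q + F (q + a + b) ≥ F (q + a) + F (q + b)) ∧
    ((a - b = d ∨ a - b = -d) → F (q + a) + F (q + b) ≥ F q + F (q + a + b))

/-- The octahedron recurrence in coordinates, on the simplex `x + y + z ≤ n` of `ℕ³`. -/
def OctahedronRec (n : ℕ) (f : ℕ → ℕ → ℕ → ℝ) : Prop :=
  ∀ x y z, x + y + z + 2 ≤ n →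
    f (x + 1) y z + f x (y + 1) (z + 1) =
      max (f (x + 1) y (z + 1) + f x (y + 1) z) (f (x + 1) (y + 1) z + f x y (z + 1))

/-- Rhombus inequalities with short diagonal `e₁` in the plane of height `y`. -/
def EdgeRhombi (n : ℕ) (f : ℕ → ℕ → ℕ → ℝ) (y : ℕ) : Prop :=
  ∀ x z, x + y + z + 2 ≤ n →
    f (x + 1) y z + f x y (z + 2) ≤ f x y (z + 1) + f (x + 1) y (z + 1)

/-- Interlacing of the increments of `x ↦ f x y z` and `x ↦ f x y (z + 1)`: the rhombus
inequalities with short diagonals `e₁ - e₃` and `e₃` in the plane of height `y`. -/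
def Interlaces (n : ℕ) (f : ℕ → ℕ → ℕ → ℝ) (y z : ℕ) : Prop :=
  ∀ x, x + y + z + 2 ≤ n →
    f (x + 1) y (z + 1) + f x y z ≤ f x y (z + 1) + f (x + 1) y z ∧
    f (x + 2) y z + f x y (z + 1) ≤ f (x + 1) y z + f (x + 1) y (z + 1)

/-- Exchange of the last two coordinates. -/
def swapYZ (f : ℕ → ℕ → ℕ → ℝ) : ℕ → ℕ → ℕ → ℝ := fun x y z => f x z y

theorem OctahedronRec.swap {n : ℕ} {f : ℕ → ℕ → ℕ → ℝ} (h : OctahedronRec n f) :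
    OctahedronRec n (swapYZ f) := by
  intro x y z hn
  have := h x z y (by omega)
  rw [max_comm] at this
  exact this

theorem OctahedronRec.le_left {n : ℕ} {f : ℕ → ℕ → ℕ → ℝ} (h : OctahedronRec n f)
    (x y z : ℕ) (hn : x + y + z + 2 ≤ n) :
    f (x + 1) y (z + 1) + f x (y + 1) z ≤ f (x + 1) y z + f x (y + 1) (z + 1) :=
  (le_max_left _ _).trans_eq (h x y z hn).symm

theorem OctahedronRec.le_right {n : ℕ} {f : ℕ → ℕ → ℕ → ℝ} (h : OctahedronRec n f)
    (x y z : ℕ) (hn : x + y + z + 2 ≤ n) :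
    f (x + 1) (y + 1) z + f x y (z + 1) ≤ f (x + 1) y z + f x (y + 1) (z + 1) :=
  (le_max_right _ _).trans_eq (h x y z hn).symm

theorem OctahedronRec.eq_or_eq {n : ℕ} {f : ℕ → ℕ → ℕ → ℝ} (h : OctahedronRec n f)
    (x y z : ℕ) (hn : x + y + z + 2 ≤ n) :
    f (x + 1) y z + f x (y + 1) (z + 1) = f (x + 1) y (z + 1) + f x (y + 1) z ∨
    f (x + 1) y z + f x (y + 1) (z + 1) = f (x + 1) (y + 1) z + f x y (z + 1) := by
  rw [h x y z hn]
  exact max_choice _ _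

theorem EdgeRhombi.succ {n : ℕ} {f : ℕ → ℕ → ℕ → ℝ} (h : OctahedronRec n f) {y : ℕ}
    (hy : EdgeRhombi n f y) : EdgeRhombi n f (y + 1) := by
  intro x z hn
  have h₁ := hy x z (by omega)
  have h₂ : f (x + 2) y z + f (x + 1) y (z + 2) ≤ f (x + 1) y (z + 1) + f (x + 2) y (z + 1) :=
    hy (x + 1) z (by omega)
  have h₃ := h.le_right x y z (by omega)
  have h₄ : f (x + 2) y (z + 1) + f (x + 1) (y + 1) z ≤
      f (x + 2) y z + f (x + 1) (y + 1) (z + 1) := h.le_left (x + 1) y z (by omega)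
  have h₅ : f (x + 1) y (z + 1) + f x (y + 1) (z + 2) =
        f (x + 1) y (z + 2) + f x (y + 1) (z + 1) ∨
      f (x + 1) y (z + 1) + f x (y + 1) (z + 2) =
        f (x + 1) (y + 1) (z + 1) + f x y (z + 2) := h.eq_or_eq x y (z + 1) (by omega)
  rcases h₅ with h₅ | h₅ <;> linarith

theorem EdgeRhombi.of_zero {n : ℕ} {f : ℕ → ℕ → ℕ → ℝ} (h : OctahedronRec n f)
    (h₀ : EdgeRhombi n f 0) (y : ℕ) : EdgeRhombi n f y := by
  induction y with
  | zero => exact h₀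
  | succ y ih => exact ih.succ h

theorem Interlaces.succ {n : ℕ} {f : ℕ → ℕ → ℕ → ℝ} (h : OctahedronRec n f) {y z : ℕ}
    (hA : Interlaces n f y z) (hB : Interlaces n (swapYZ f) z y) :
    Interlaces n f (y + 1) z := by
  intro x hn
  obtain ⟨a₁, a₂⟩ := hA x (by omega)
  obtain ⟨b₁, b₂⟩ := hB x (by omega)
  have a₃ : f (x + 2) y (z + 1) + f (x + 1) y z ≤ f (x + 1) y (z + 1) + f (x + 2) y z :=
    (hA (x + 1) (by omega)).1
  have b₃ : f (x + 2) (y + 1) z + f (x + 1) y z ≤ f (x + 1) (y + 1) z + f (x + 2) y z :=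
    (hB (x + 1) (by omega)).1
  simp only [swapYZ] at b₁ b₂
  have c : f (x + 2) y z + f (x + 1) (y + 1) (z + 1) =
        f (x + 2) y (z + 1) + f (x + 1) (y + 1) z ∨
      f (x + 2) y z + f (x + 1) (y + 1) (z + 1) =
        f (x + 2) (y + 1) z + f (x + 1) y (z + 1) := h.eq_or_eq (x + 1) y z (by omega)
  have d₁ := h.le_left x y z (by omega)
  have d₂ := h.le_right x y z (by omega)
  have e₁ : f (x + 2) y (z + 1) + f (x + 1) (y + 1) z ≤
      f (x + 2) y z + f (x + 1) (y + 1) (z + 1) := h.le_left (x + 1) y z (by omega)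
  have e₂ : f (x + 2) (y + 1) z + f (x + 1) y (z + 1) ≤
      f (x + 2) y z + f (x + 1) (y + 1) (z + 1) := h.le_right (x + 1) y z (by omega)
  constructor
  · rcases c with c | c <;> linarith
  · rcases h.eq_or_eq x y z (by omega) with d | d <;> linarith

theorem Interlaces.of_zero {n : ℕ} {f : ℕ → ℕ → ℕ → ℝ} (h : OctahedronRec n f)
    (hA : ∀ z, Interlaces n f 0 z) (hB : ∀ y, Interlaces n (swapYZ f) 0 y) (y : ℕ) :
    ∀ z, Interlaces n f y z ∧ Interlaces n (swapYZ f) z y := by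
  have key : ∀ y, (∀ z, Interlaces n f y z) → ∀ z, Interlaces n (swapYZ f) z y := by
    intro y hy z
    induction z with
    | zero => exact hB y
    | succ z ih => exact ih.succ h.swap (hy z)
  have main : ∀ z, Interlaces n f y z := by
    induction y with
    | zero => exact hA
    | succ y ih => exact fun z => (ih z).succ h (key y ih z)
  exact fun z => ⟨main z, key y main z⟩

theorem mem_pmD {x y z : ℤ} : ((x, y, z) : V3) ∈ pmD ↔
    (|x| ≤ 1 ∧ |y| ≤ 1 ∧ |z| ≤ 1 ∧ |x + y| ≤ 1 ∧ |x + z| ≤ 1 ∧ |y + z| ≤ 1 ∧ |x + y + z| ≤ 1) ∧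
      ¬(x = 0 ∧ y = 0 ∧ z = 0) := by
  simp only [pmD, Dset, e1, e2, e3, Set.mem_insert_iff, Set.mem_singleton_iff, Set.mem_ofPred_eq,
    Prod.mk.injEq, Prod.neg_mk, Prod.mk_sub_mk, abs_le]
  constructor
  · rintro ((h | h | h | h | h | h) | (h | h | h | h | h | h)) <;> omega
  · rintro ⟨⟨⟨h₁, h₂⟩, ⟨h₃, h₄⟩, ⟨h₅, h₆⟩, h⟩, h₀⟩
    interval_cases x <;> interval_cases y <;> interval_cases z <;> simp_all

/-- The unit vectors of the triangular lattice. -/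
theorem triangular_cases {a b : ℤ} (h : |a| ≤ 1 ∧ |b| ≤ 1 ∧ |a + b| ≤ 1)
    (h₀ : ¬(a = 0 ∧ b = 0)) :
    (a = 1 ∧ b = 0) ∨ (a = 0 ∧ b = 1) ∨ (a = 1 ∧ b = -1) ∨
    (a = -1 ∧ b = 0) ∨ (a = 0 ∧ b = -1) ∨ (a = -1 ∧ b = 1) := by
  simp only [abs_le] at h
  obtain ⟨⟨h₁, h₂⟩, ⟨h₃, h₄⟩, h₅⟩ := h
  interval_cases a <;> interval_cases b <;> simp_all

/-- The pairs of unit vectors of the triangular lattice whose sum is a unit vector. -/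
theorem triangular_pairs {a b c d : ℤ} (ha : |a| ≤ 1 ∧ |b| ≤ 1 ∧ |a + b| ≤ 1)
    (hc : |c| ≤ 1 ∧ |d| ≤ 1 ∧ |c + d| ≤ 1)
    (hac : |a + c| ≤ 1 ∧ |b + d| ≤ 1 ∧ |a + c + (b + d)| ≤ 1)
    (ha₀ : ¬(a = 0 ∧ b = 0)) (hc₀ : ¬(c = 0 ∧ d = 0)) (hac₀ : ¬(a + c = 0 ∧ b + d = 0)) :
    (a = 1 ∧ b = 0 ∧ (c = 0 ∧ d = -1 ∨ c = -1 ∧ d = 1)) ∨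
    (a = 0 ∧ b = 1 ∧ (c = -1 ∧ d = 0 ∨ c = 1 ∧ d = -1)) ∨
    (a = 1 ∧ b = -1 ∧ (c = 0 ∧ d = 1 ∨ c = -1 ∧ d = 0)) ∨
    (a = -1 ∧ b = 0 ∧ (c = 0 ∧ d = 1 ∨ c = 1 ∧ d = -1)) ∨
    (a = 0 ∧ b = -1 ∧ (c = 1 ∧ d = 0 ∨ c = -1 ∧ d = 1)) ∨
    (a = -1 ∧ b = 1 ∧ (c = 0 ∧ d = -1 ∨ c = 1 ∧ d = 0)) := by
  have h := triangular_cases hac hac₀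
  rcases triangular_cases ha ha₀ with h₁ | h₁ | h₁ | h₁ | h₁ | h₁ <;>
  rcases triangular_cases hc hc₀ with h₂ | h₂ | h₂ | h₂ | h₂ | h₂ <;>
  obtain ⟨rfl, rfl⟩ := h₁ <;> obtain ⟨rfl, rfl⟩ := h₂ <;> revert h <;> decide

theorem neg_mem_pmD {v : V3} (h : v ∈ pmD) : -v ∈ pmD := by
  rcases h with h | h
  · exact Or.inr (by rwa [neg_neg])
  · exact Or.inl h

/-- It suffices to check the rhombi whose short diagonal is `(q, q + a + b)`. -/
theorem discreteConcaveOn_of_add_mem {S : Set V3} {F : V3 → ℝ}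
    (h : ∀ q a b : V3, a ∈ pmD → b ∈ pmD → a + b ∈ pmD → q ∈ S → q + a ∈ S → q + b ∈ S →
      q + a + b ∈ S → F (q + a) + F (q + b) ≤ F q + F (q + a + b)) :
    DiscreteConcaveOn S F := by
  rintro q a b ⟨ha, hb, -, -, -⟩ h₀ h₁ h₂ h₃
  refine ⟨fun hab => h q a b ha hb hab h₀ h₁ h₂ h₃, fun hab => ?_⟩
  have e₁ : q + b + a = q + a + b := by abel
  have e₂ : q + b + -b = q := by abel
  have e₃ : q + a + b + -b = q + a := by abel
  have := h (q + b) a (-b) ha (neg_mem_pmD hb) (by rwa [← sub_eq_add_neg]) h₂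
    (by rwa [e₁]) (by rwa [e₂]) (by rwa [e₁, e₃])
  rw [e₁, e₂, e₃] at this
  linarith

theorem DiscreteConcaveOn.le_of_add_mem {S : Set V3} {F : V3 → ℝ} (h : DiscreteConcaveOn S F)
    (q a b : V3) (hab : a + b ∈ pmD ∧ IsPrimRhombus a b)
    (hq : q ∈ S ∧ q + a ∈ S ∧ q + b ∈ S ∧ q + a + b ∈ S) :
    F (q + a) + F (q + b) ≤ F q + F (q + a + b) :=
  (h q a b hab.2 hq.1 hq.2.1 hq.2.2.1 hq.2.2.2).1 hab.1

/-- A function on `ℤ³` read in natural number coordinates. -/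
def natCoord (F : V3 → ℝ) : ℕ → ℕ → ℕ → ℝ := fun x y z => F ((x : ℤ), (y : ℤ), (z : ℤ))

theorem IsPolarizedOn.octahedronRec {n : ℕ} {F : V3 → ℝ} (h : IsPolarizedOn (Tet n) F) :
    OctahedronRec n (natCoord F) := by
  intro x y z hn
  have := h ((x : ℤ) + 1, (y : ℤ), (z : ℤ))
  simp only [Tet, Set.mem_ofPred_eq, Prod.mk_add_mk, add_zero, add_neg_cancel_right] at this
  simp only [natCoord, Nat.cast_add, Nat.cast_one]
  refine this ?_ ?_ ?_ ?_ ?_ ?_ <;> omega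

theorem DiscreteConcaveOn.edgeRhombi_front {n : ℕ} {F : V3 → ℝ}
    (h : DiscreteConcaveOn (frontWall n) F) : EdgeRhombi n (natCoord F) 0 := by
  intro x z hn
  have := h.le_of_add_mem ((x : ℤ), 0, (z : ℤ) + 1) (1, 0, -1) (0, 0, 1)
    (by simp [IsPrimRhombus, mem_pmD])
    (by simp only [frontWall, Tet, Set.mem_ofPred_eq, Prod.mk_add_mk, and_true]; omega)
  simp only [natCoord]
  simp only [Prod.mk_add_mk] at this
  push_cast
  ring_nf at this ⊢
  linarith

theorem DiscreteConcaveOn.edgeRhombi_ground {n : ℕ} {F : V3 → ℝ}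
    (h : DiscreteConcaveOn (ground n) F) : EdgeRhombi n (swapYZ (natCoord F)) 0 := by
  intro x z hn
  have := h.le_of_add_mem ((x : ℤ), (z : ℤ) + 1, 0) (1, -1, 0) (0, 1, 0)
    (by simp [IsPrimRhombus, mem_pmD])
    (by simp only [ground, Tet, Set.mem_ofPred_eq, Prod.mk_add_mk, and_true]; omega)
  simp only [natCoord, swapYZ]
  simp only [Prod.mk_add_mk] at this
  push_cast
  ring_nf at this ⊢
  linarith

theorem DiscreteConcaveOn.interlaces_front {n : ℕ} {F : V3 → ℝ}
    (h : DiscreteConcaveOn (frontWall n) F) (z : ℕ) : Interlaces n (natCoord F) 0 z := by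
  intro x hn
  have h₁ := h.le_of_add_mem ((x : ℤ), 0, (z : ℤ) + 1) (1, 0, 0) (0, 0, -1)
    (by simp [IsPrimRhombus, mem_pmD])
    (by simp only [frontWall, Tet, Set.mem_ofPred_eq, Prod.mk_add_mk, and_true]; omega)
  have h₂ := h.le_of_add_mem ((x : ℤ) + 1, 0, (z : ℤ)) (1, 0, 0) (-1, 0, 1)
    (by simp [IsPrimRhombus, mem_pmD])
    (by simp only [frontWall, Tet, Set.mem_ofPred_eq, Prod.mk_add_mk, and_true]; omega)
  simp only [natCoord]
  simp only [Prod.mk_add_mk] at h₁ h₂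
  push_cast
  ring_nf at h₁ h₂ ⊢
  constructor <;> linarith

theorem DiscreteConcaveOn.interlaces_ground {n : ℕ} {F : V3 → ℝ}
    (h : DiscreteConcaveOn (ground n) F) (z : ℕ) : Interlaces n (swapYZ (natCoord F)) 0 z := by
  intro x hn
  have h₁ := h.le_of_add_mem ((x : ℤ), (z : ℤ) + 1, 0) (1, 0, 0) (0, -1, 0)
    (by simp [IsPrimRhombus, mem_pmD])
    (by simp only [ground, Tet, Set.mem_ofPred_eq, Prod.mk_add_mk, and_true]; omega)
  have h₂ := h.le_of_add_mem ((x : ℤ) + 1, (z : ℤ), 0) (1, 0, 0) (-1, 1, 0)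
    (by simp [IsPrimRhombus, mem_pmD])
    (by simp only [ground, Tet, Set.mem_ofPred_eq, Prod.mk_add_mk, and_true]; omega)
  simp only [natCoord, swapYZ]
  simp only [Prod.mk_add_mk] at h₁ h₂
  push_cast
  ring_nf at h₁ h₂ ⊢
  constructor <;> linarith

/-- Rhombi with short diagonal `e₂` in the planes of constant `x`. -/
theorem EdgeRhombi.le_const_x {n : ℕ} {f : ℕ → ℕ → ℕ → ℝ} (h : OctahedronRec n f) {y : ℕ}
    (hy : EdgeRhombi n f y) (x z : ℕ) (hn : x + y + z + 2 ≤ n) :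
    f x y (z + 2) + f x (y + 1) z ≤ f x y (z + 1) + f x (y + 1) (z + 1) := by
  linarith [hy x z hn, h.le_left x y z hn]

/-- Rhombi with short diagonal `e₁ - e₂` in the planes of constant `x + y + z`. -/
theorem EdgeRhombi.le_const_sum {n : ℕ} {f : ℕ → ℕ → ℕ → ℝ} (h : OctahedronRec n f) {y : ℕ}
    (hy : EdgeRhombi n f y) (x z : ℕ) (hn : x + y + z + 2 ≤ n) :
    f (x + 1) (y + 1) z + f x y (z + 2) ≤ f x (y + 1) (z + 1) + f (x + 1) y (z + 1) := by
  linarith [hy x z hn, h.le_right x y z hn]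

/-- Rhombi with short diagonal `e₂ - e₃` in the planes of constant `x`. -/
theorem Interlaces.le_const_x {n : ℕ} {f : ℕ → ℕ → ℕ → ℝ} (h : OctahedronRec n f) {y z : ℕ}
    (hA : Interlaces n f y z) (hB : Interlaces n (swapYZ f) z y)
    (x : ℕ) (hn : x + y + z + 2 ≤ n) :
    f x y z + f x (y + 1) (z + 1) ≤ f x (y + 1) z + f x y (z + 1) := by
  have a := (hA x hn).1
  have b : f (x + 1) (y + 1) z + f x y z ≤ f x (y + 1) z + f (x + 1) y z :=
    (hB x (by omega)).1
  rcases h.eq_or_eq x y z hn with c | c <;> linarith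

/-- Rhombi with short diagonal `e₂ - e₃` in the planes of constant `x + y + z`. -/
theorem Interlaces.le_const_sum {n : ℕ} {f : ℕ → ℕ → ℕ → ℝ} (h : OctahedronRec n f) {y z : ℕ}
    (hA : Interlaces n f y z) (hB : Interlaces n (swapYZ f) z y)
    (x : ℕ) (hn : x + y + z + 2 ≤ n) :
    f (x + 2) y z + f x (y + 1) (z + 1) ≤ f (x + 1) (y + 1) z + f (x + 1) y (z + 1) := by
  have a := (hA x hn).2
  have b : f (x + 2) y z + f x (y + 1) z ≤ f (x + 1) y z + f (x + 1) (y + 1) z :=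
    (hB x (by omega)).2
  rcases h.eq_or_eq x y z hn with c | c <;> linarith

/-- The three families of rhombus inequalities of the shadow wall imply its concavity. -/
theorem discreteConcaveOn_shadowWall {n : ℕ} {F : V3 → ℝ}
    (h₂ : ∀ y z : ℕ, y + z + 2 ≤ n →
      natCoord F 0 y (z + 2) + natCoord F 0 (y + 1) z ≤
        natCoord F 0 y (z + 1) + natCoord F 0 (y + 1) (z + 1))
    (h₃ : ∀ y z : ℕ, y + z + 2 ≤ n →
      natCoord F 0 (y + 2) z + natCoord F 0 y (z + 1) ≤
        natCoord F 0 (y + 1) z + natCoord F 0 (y + 1) (z + 1))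
    (h₂₃ : ∀ y z : ℕ, y + z + 2 ≤ n →
      natCoord F 0 y z + natCoord F 0 (y + 1) (z + 1) ≤
        natCoord F 0 (y + 1) z + natCoord F 0 y (z + 1)) :
    DiscreteConcaveOn (shadowWall n) F := by
  have k₂ : ∀ y z : ℤ, 0 ≤ y → 1 ≤ z → y + z + 1 ≤ n →
      F (0, y, z + 1) + F (0, y + 1, z - 1) ≤ F (0, y, z) + F (0, y + 1, z) := by
    intro y z hy hz hn
    obtain ⟨z, rfl⟩ : ∃ w, z = w + 1 := ⟨z - 1, by ring⟩
    lift y to ℕ using hy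
    lift z to ℕ using (by omega)
    have := h₂ y z (by omega)
    simp only [natCoord] at this
    push_cast at this
    ring_nf at this ⊢
    linarith
  have k₃ : ∀ y z : ℤ, 1 ≤ y → 0 ≤ z → y + z + 1 ≤ n →
      F (0, y + 1, z) + F (0, y - 1, z + 1) ≤ F (0, y, z) + F (0, y, z + 1) := by
    intro y z hy hz hn
    obtain ⟨y, rfl⟩ : ∃ w, y = w + 1 := ⟨y - 1, by ring⟩
    lift z to ℕ using hz
    lift y to ℕ using (by omega)
    have := h₃ y z (by omega)
    simp only [natCoord] at this
    push_cast at this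
    ring_nf at this ⊢
    linarith
  have k₂₃ : ∀ y z : ℤ, 0 ≤ y → 0 ≤ z → y + z + 2 ≤ n →
      F (0, y, z) + F (0, y + 1, z + 1) ≤ F (0, y + 1, z) + F (0, y, z + 1) := by
    intro y z hy hz hn
    lift y to ℕ using hy
    lift z to ℕ using hz
    have := h₂₃ y z (by omega)
    simp only [natCoord] at this
    push_cast at this
    linarith
  apply discreteConcaveOn_of_add_mem
  rintro ⟨x, y, z⟩ ⟨a₁, a₂, a₃⟩ ⟨b₁, b₂, b₃⟩ ha hb hab q₀ q₁ q₂ q₃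
  simp only [Prod.mk_add_mk, shadowWall, Tet, Set.mem_ofPred_eq, mem_pmD] at *
  obtain rfl : x = 0 := q₀.2
  obtain rfl : a₁ = 0 := by linarith
  obtain rfl : b₁ = 0 := by linarith
  have cases := triangular_pairs (a := a₂) (b := a₃) (c := b₂) (d := b₃)
    (by simp only [abs_le] at *; omega) (by simp only [abs_le] at *; omega)
    (by simp only [abs_le] at *; omega) (by omega) (by omega) (by omega)
  clear ha hb hab
  rcases cases with ⟨rfl, rfl, h⟩ | ⟨rfl, rfl, h⟩ | ⟨rfl, rfl, h⟩ | ⟨rfl, rfl, h⟩ |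
    ⟨rfl, rfl, h⟩ | ⟨rfl, rfl, h⟩ <;>
  rcases h with ⟨rfl, rfl⟩ | ⟨rfl, rfl⟩ <;>
  first
  | (have := k₂ y z (by omega) (by omega) (by omega); ring_nf at this ⊢; linarith)
  | (have := k₂ (y - 1) z (by omega) (by omega) (by omega); ring_nf at this ⊢; linarith)
  | (have := k₃ y z (by omega) (by omega) (by omega); ring_nf at this ⊢; linarith)
  | (have := k₃ y (z - 1) (by omega) (by omega) (by omega); ring_nf at this ⊢; linarith)
  | (have := k₂₃ (y - 1) z (by omega) (by omega) (by omega); ring_nf at this ⊢; linarith)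
  | (have := k₂₃ y (z - 1) (by omega) (by omega) (by omega); ring_nf at this ⊢; linarith)

/-- The three families of rhombus inequalities of the slope wall imply its concavity. -/
theorem discreteConcaveOn_slopeWall {n : ℕ} {F : V3 → ℝ}
    (h₁₂ : ∀ x y z : ℕ, x + y + z + 2 = n →
      natCoord F (x + 1) (y + 1) z + natCoord F x y (z + 2) ≤
        natCoord F x (y + 1) (z + 1) + natCoord F (x + 1) y (z + 1))
    (h₁₃ : ∀ x y z : ℕ, x + y + z + 2 = n →
      natCoord F (x + 1) y (z + 1) + natCoord F x (y + 2) z ≤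
        natCoord F x (y + 1) (z + 1) + natCoord F (x + 1) (y + 1) z)
    (h₂₃ : ∀ x y z : ℕ, x + y + z + 2 = n →
      natCoord F (x + 2) y z + natCoord F x (y + 1) (z + 1) ≤
        natCoord F (x + 1) (y + 1) z + natCoord F (x + 1) y (z + 1)) :
    DiscreteConcaveOn (slopeWall n) F := by
  have k₁₂ : ∀ x y z : ℤ, 0 ≤ x → 1 ≤ y → 1 ≤ z → x + y + z = n →
      F (x + 1, y, z - 1) + F (x, y - 1, z + 1) ≤ F (x, y, z) + F (x + 1, y - 1, z) := by
    intro x y z hx hy hz hn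
    obtain ⟨y, rfl⟩ : ∃ w, y = w + 1 := ⟨y - 1, by ring⟩
    obtain ⟨z, rfl⟩ : ∃ w, z = w + 1 := ⟨z - 1, by ring⟩
    lift x to ℕ using hx
    lift y to ℕ using (by omega)
    lift z to ℕ using (by omega)
    have := h₁₂ x y z (by omega)
    simp only [natCoord] at this
    push_cast at this
    ring_nf at this ⊢
    linarith
  have k₁₃ : ∀ x y z : ℤ, 0 ≤ x → 1 ≤ y → 1 ≤ z → x + y + z = n →
      F (x + 1, y - 1, z) + F (x, y + 1, z - 1) ≤ F (x, y, z) + F (x + 1, y, z - 1) := by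
    intro x y z hx hy hz hn
    obtain ⟨y, rfl⟩ : ∃ w, y = w + 1 := ⟨y - 1, by ring⟩
    obtain ⟨z, rfl⟩ : ∃ w, z = w + 1 := ⟨z - 1, by ring⟩
    lift x to ℕ using hx
    lift y to ℕ using (by omega)
    lift z to ℕ using (by omega)
    have := h₁₃ x y z (by omega)
    simp only [natCoord] at this
    push_cast at this
    ring_nf at this ⊢
    linarith
  have k₂₃ : ∀ x y z : ℤ, 1 ≤ x → 1 ≤ y → 0 ≤ z → x + y + z = n →
      F (x + 1, y - 1, z) + F (x - 1, y, z + 1) ≤ F (x, y, z) + F (x, y - 1, z + 1) := by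
    intro x y z hx hy hz hn
    obtain ⟨x, rfl⟩ : ∃ w, x = w + 1 := ⟨x - 1, by ring⟩
    obtain ⟨y, rfl⟩ : ∃ w, y = w + 1 := ⟨y - 1, by ring⟩
    lift z to ℕ using hz
    lift x to ℕ using (by omega)
    lift y to ℕ using (by omega)
    have := h₂₃ x y z (by omega)
    simp only [natCoord] at this
    push_cast at this
    ring_nf at this ⊢
    linarith
  apply discreteConcaveOn_of_add_mem
  rintro ⟨x, y, z⟩ ⟨a₁, a₂, a₃⟩ ⟨b₁, b₂, b₃⟩ ha hb hab q₀ q₁ q₂ q₃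
  simp only [Prod.mk_add_mk, slopeWall, Tet, Set.mem_ofPred_eq, mem_pmD] at *
  obtain rfl : a₁ = -a₂ - a₃ := by linarith
  obtain rfl : b₁ = -b₂ - b₃ := by linarith
  have cases := triangular_pairs (a := a₂) (b := a₃) (c := b₂) (d := b₃)
    (by simp only [abs_le] at *; omega) (by simp only [abs_le] at *; omega)
    (by simp only [abs_le] at *; omega) (by omega) (by omega) (by omega)
  clear ha hb hab
  rcases cases with ⟨rfl, rfl, h⟩ | ⟨rfl, rfl, h⟩ | ⟨rfl, rfl, h⟩ | ⟨rfl, rfl, h⟩ |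
    ⟨rfl, rfl, h⟩ | ⟨rfl, rfl, h⟩ <;>
  rcases h with ⟨rfl, rfl⟩ | ⟨rfl, rfl⟩ <;>
  first
  | (have := k₁₂ x y z (by omega) (by omega) (by omega) (by omega)
     ring_nf at this ⊢; linarith)
  | (have := k₁₂ (x - 1) (y + 1) z (by omega) (by omega) (by omega) (by omega)
     ring_nf at this ⊢; linarith)
  | (have := k₁₃ x y z (by omega) (by omega) (by omega) (by omega)
     ring_nf at this ⊢; linarith)
  | (have := k₁₃ (x - 1) y (z + 1) (by omega) (by omega) (by omega) (by omega)
     ring_nf at this ⊢; linarith)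
  | (have := k₂₃ x y z (by omega) (by omega) (by omega) (by omega)
     ring_nf at this ⊢; linarith)
  | (have := k₂₃ x (y + 1) (z - 1) (by omega) (by omega) (by omega) (by omega)
     ring_nf at this ⊢; linarith)

/-- if a polarized function on `Δ_n(OXYZ)` has discrete concave restrictions to
the ground and the front wall, then its restrictions to the shadow wall and the slope wall are
also discrete concave. -/
theorem tet_shadow_slope_discrete_concave (n : ℕ) (F : V3 → ℝ)
    (hpol : IsPolarizedOn (Tet n) F)
    (hground : DiscreteConcaveOn (ground n) F)
    (hfront : DiscreteConcaveOn (frontWall n) F) :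
    DiscreteConcaveOn (shadowWall n) F ∧ DiscreteConcaveOn (slopeWall n) F := by
  have h := hpol.octahedronRec
  have edgeY := EdgeRhombi.of_zero h hfront.edgeRhombi_front
  have edgeZ := EdgeRhombi.of_zero h.swap hground.edgeRhombi_ground
  have inter := Interlaces.of_zero h hfront.interlaces_front hground.interlaces_ground
  constructor
  · apply discreteConcaveOn_shadowWall
    · intro y z hn
      exact (edgeY y).le_const_x h 0 z (by omega)
    · intro y z hn
      have := (edgeZ z).le_const_x h.swap 0 y (by omega)
      exact this
    · intro y z hn
      exact (inter y z).1.le_const_x h (inter y z).2 0 (by omega)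
  · apply discreteConcaveOn_slopeWall
    · intro x y z hn
      exact (edgeY y).le_const_sum h x z (by omega)
    · intro x y z hn
      exact (edgeZ z).le_const_sum h.swap x y (by omega)
    · intro x y z hn
      exact (inter y z).1.le_const_sum h (inter y z).2 x (by omega)
end

section
/- Let n ∈ ℕ and let F : Δ_n(OXYZ) → ℝ be a polarized function on the tetrahedral grid Δ_n(OXYZ). Assume the restriction of F to the ground (face z = 0) is discrete concave, and the restriction of F to the front wall (face y = 0) is HS-concave with horizontal direction e₁, i.e. strip-concave along e₁ (the families R(e₃) and R(e₁−e₃) of rhombus inequalities hold on the front wall). Then the restriction of F to the shadow wall (face x = 0) is HS-concave with horizontal direction e₂, i.e. strip-concave along e₂ (R(e₃) and R(e₂−e₃) hold), and the restriction of F to the slope wall (face x+y+z = n) is HS-concave with horizontal direction e₁−e₂, i.e. strip-concave along e₁−e₂ (R(e₁−e₃) and R(e₂−e₃) hold). -/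
/-- Discrete concavity of a function on the triangular grid `{(x, y) | x + y ≤ m}`. -/
structure TriConcave (m : ℕ) (f : ℕ → ℕ → ℝ) : Prop where
  diag : ∀ x y, x + y + 2 ≤ m → f x y + f (x + 1) (y + 1) ≤ f (x + 1) y + f x (y + 1)
  vert : ∀ x y, x + y + 2 ≤ m → f (x + 2) y + f x (y + 1) ≤ f (x + 1) y + f (x + 1) (y + 1)
  horiz : ∀ x y, x + y + 2 ≤ m → f x (y + 2) + f (x + 1) y ≤ f x (y + 1) + f (x + 1) (y + 1)

/-- The octahedron recurrence between two consecutive layers `f` (of size `m + 1`) and `g`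
(of size `m`). -/
def OctRec (m : ℕ) (f g : ℕ → ℕ → ℝ) : Prop :=
  ∀ x y, x + y + 1 ≤ m →
    f (x + 1) y + g x (y + 1) = max (g (x + 1) y + f x (y + 1)) (f (x + 1) (y + 1) + g x y)

/-- The rows at height `y` of two consecutive layers interlace. -/
def RowInterlace (m : ℕ) (f g : ℕ → ℕ → ℝ) (y : ℕ) : Prop :=
  ∀ x, x + y + 1 ≤ m →
    g x y + f (x + 2) y ≤ g (x + 1) y + f (x + 1) y ∧
    g (x + 1) y + f x y ≤ f (x + 1) y + g x y

section Layers

variable {m : ℕ} {f g : ℕ → ℕ → ℝ}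

theorem OctRec.le_left (h : OctRec m f g) {x y : ℕ} (hxy : x + y + 1 ≤ m) :
    g (x + 1) y + f x (y + 1) ≤ f (x + 1) y + g x (y + 1) :=
  (h x y hxy).symm ▸ le_max_left _ _

theorem OctRec.le_right (h : OctRec m f g) {x y : ℕ} (hxy : x + y + 1 ≤ m) :
    f (x + 1) (y + 1) + g x y ≤ f (x + 1) y + g x (y + 1) :=
  (h x y hxy).symm ▸ le_max_right _ _

theorem OctRec.eq_or_eq (h : OctRec m f g) {x y : ℕ} (hxy : x + y + 1 ≤ m) :
    f (x + 1) y + g x (y + 1) = g (x + 1) y + f x (y + 1) ∨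
      f (x + 1) y + g x (y + 1) = f (x + 1) (y + 1) + g x y := by
  rw [h x y hxy]
  exact max_choice _ _

theorem RowInterlace.of_zero (hf : TriConcave (m + 1) f) (h : OctRec m f g)
    (h0 : RowInterlace m f g 0) (y : ℕ) : RowInterlace m f g y := by
  induction y with
  | zero => exact h0
  | succ y ih =>
    intro x hx
    have hl := h.le_left (x := x) (y := y) (by omega)
    have hr := h.le_right (x := x + 1) (y := y) (by omega)
    constructor
    · rcases h.eq_or_eq (x := x) (y := y) (by omega) with e | e
      · linarith [hf.vert x y (by omega)]
      · linarith [(ih x (by omega)).1]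
    · rcases h.eq_or_eq (x := x + 1) (y := y) (by omega) with e | e
      · linarith [(ih (x + 1) (by omega)).2]
      · linarith [hf.diag (x + 1) y (by omega)]

theorem OctRec.short_e3_shadow (hf : TriConcave (m + 1) f) (h : OctRec m f g) {x y : ℕ}
    (hxy : x + y + 1 ≤ m) : f x (y + 2) + g x y ≤ f x (y + 1) + g x (y + 1) := by
  linarith [h.le_right hxy, hf.horiz x y (by omega)]

theorem OctRec.short_e2_sub_e3_shadow (hf : TriConcave (m + 1) f) (h : OctRec m f g) {x y : ℕ}
    (hi : RowInterlace m f g y) (hxy : x + y + 1 ≤ m) :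
    f x y + g x (y + 1) ≤ f x (y + 1) + g x y := by
  rcases h.eq_or_eq hxy with e | e
  · linarith [(hi x hxy).2]
  · linarith [hf.diag x y (by omega)]

theorem OctRec.short_e1_sub_e3_slope (hf : TriConcave (m + 1) f) (h : OctRec m f g) {x y : ℕ}
    (hxy : x + y + 1 ≤ m) : g (x + 1) y + f x (y + 2) ≤ g x (y + 1) + f (x + 1) (y + 1) := by
  linarith [h.le_left hxy, hf.horiz x y (by omega)]

theorem OctRec.short_e2_sub_e3_slope (hf : TriConcave (m + 1) f) (h : OctRec m f g) {x y : ℕ}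
    (hi : RowInterlace m f g y) (hxy : x + y + 1 ≤ m) :
    g x (y + 1) + f (x + 2) y ≤ g (x + 1) y + f (x + 1) (y + 1) := by
  rcases h.eq_or_eq hxy with e | e
  · linarith [hf.vert x y (by omega)]
  · linarith [(hi x hxy).1]

theorem TriConcave.of_octRec (hf : TriConcave (m + 1) f) (h : OctRec m f g)
    (hi : ∀ y, RowInterlace m f g y) : TriConcave m g where
  diag x y hxy := by
    have hr := h.le_right (x := x) (y := y) (by omega)
    rcases h.eq_or_eq (x := x + 1) (y := y) (by omega) with e | e
    · linarith [(hi y (x + 1) (by omega)).2]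
    · linarith [hf.diag (x + 1) y (by omega)]
  vert x y hxy := by
    have hl := h.le_left (x := x + 1) (y := y) (by omega)
    rcases h.eq_or_eq (x := x) (y := y) (by omega) with e | e
    · linarith [hf.vert x y (by omega)]
    · linarith [(hi y x (by omega)).1]
  horiz x y hxy := by
    rcases h.eq_or_eq (x := x) (y := y + 1) (by omega) with e | e
    · linarith [h.short_e1_sub_e3_slope hf (x := x) (y := y) (by omega)]
    · linarith [h.short_e3_shadow hf (x := x + 1) (y := y) (by omega)]

end Layers

/-- The layer of `F` at height `z`. -/
def layer (F : V3 → ℝ) (z x y : ℕ) : ℝ := F (x, y, z)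

theorem mem_pmD_iff (v : V3) :
    v ∈ pmD ↔ v = (1, 0, 0) ∨ v = (0, 1, 0) ∨ v = (0, 0, 1) ∨ v = (1, -1, 0) ∨
      v = (1, 0, -1) ∨ v = (0, 1, -1) ∨ v = (-1, 0, 0) ∨ v = (0, -1, 0) ∨ v = (0, 0, -1) ∨
      v = (-1, 1, 0) ∨ v = (-1, 0, 1) ∨ v = (0, -1, 1) := by
  simp [pmD, Dset, e1, e2, e3, neg_eq_iff_eq_neg, or_assoc]

instance (v : V3) : Decidable (v ∈ pmD) := decidable_of_iff _ (mem_pmD_iff v).symm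

instance (a b : V3) : Decidable (IsPrimRhombus a b) := by
  unfold IsPrimRhombus
  infer_instance

theorem mem_Tet_mk {n : ℕ} {x y z : ℤ} :
    (x, y, z) ∈ Tet n ↔ 0 ≤ x ∧ 0 ≤ y ∧ 0 ≤ z ∧ x + y + z ≤ n := Iff.rfl

theorem mem_ground_mk {n : ℕ} {x y z : ℤ} :
    (x, y, z) ∈ ground n ↔ (x, y, z) ∈ Tet n ∧ z = 0 := Iff.rfl

theorem mem_frontWall_mk {n : ℕ} {x y z : ℤ} :
    (x, y, z) ∈ frontWall n ↔ (x, y, z) ∈ Tet n ∧ y = 0 := Iff.rfl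

theorem mem_shadowWall_mk {n : ℕ} {x y z : ℤ} :
    (x, y, z) ∈ shadowWall n ↔ (x, y, z) ∈ Tet n ∧ x = 0 := Iff.rfl

theorem mem_slopeWall_mk {n : ℕ} {x y z : ℤ} :
    (x, y, z) ∈ slopeWall n ↔ (x, y, z) ∈ Tet n ∧ x + y + z = n := Iff.rfl

theorem IsPolarizedOn.octRec {n : ℕ} {F : V3 → ℝ} (h : IsPolarizedOn (Tet n) F) {k m : ℕ}
    (hk : k + 1 + m = n) : OctRec m (layer F k) (layer F (k + 1)) := by
  intro x y hxy
  have := h ((x : ℤ) + 1, y, k)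
  simp only [Prod.mk_add_mk, mem_Tet_mk] at this
  have := this (by omega) (by omega) (by omega) (by omega) (by omega) (by omega)
  simp only [layer]
  push_cast
  simpa [add_assoc] using this

theorem TriConcave.of_ground {n : ℕ} {F : V3 → ℝ} (h : DiscreteConcaveOn (ground n) F) :
    TriConcave n (layer F 0) where
  diag x y hxy := by
    have := h ((x : ℤ), y, 0) (1, 0, 0) (0, 1, 0) (by decide)
    simp only [Prod.mk_add_mk, mem_ground_mk, mem_Tet_mk, add_zero, and_true] at this
    have := (this (by omega) (by omega) (by omega) (by omega)).2 (by decide)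
    simpa [layer] using this
  vert x y hxy := by
    have := h ((x : ℤ) + 1, y, 0) (1, 0, 0) (-1, 1, 0) (by decide)
    simp only [Prod.mk_add_mk, mem_ground_mk, mem_Tet_mk, add_zero, and_true] at this
    have := (this (by omega) (by omega) (by omega) (by omega)).1 (by decide)
    simpa [layer, add_assoc] using this
  horiz x y hxy := by
    have := h ((x : ℤ), (y : ℤ) + 1, 0) (0, 1, 0) (1, -1, 0) (by decide)
    simp only [Prod.mk_add_mk, mem_ground_mk, mem_Tet_mk, add_zero, and_true] at this
    have := (this (by omega) (by omega) (by omega) (by omega)).1 (by decide)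
    simpa [layer, add_assoc] using this

theorem RowInterlace.of_frontWall {n : ℕ} {F : V3 → ℝ} (h₁ : FaceR (frontWall n) F e3)
    (h₂ : FaceR (frontWall n) F (e1 - e3)) {k m : ℕ} (hk : k + 1 + m = n) :
    RowInterlace m (layer F k) (layer F (k + 1)) 0 := by
  intro x hx
  constructor
  · have := h₁ ((x : ℤ) + 1, 0, k) (1, 0, 0) (-1, 0, 1) (by decide)
    simp only [Prod.mk_add_mk, mem_frontWall_mk, mem_Tet_mk, add_zero, and_true] at this
    have := (this (by omega) (by omega) (by omega) (by omega)).1 (by decide)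
    simp [add_assoc] at this
    simp [layer]
    linarith
  · have := h₂ ((x : ℤ), 0, k) (1, 0, 0) (0, 0, 1) (by decide)
    simp only [Prod.mk_add_mk, mem_frontWall_mk, mem_Tet_mk, add_zero, and_true] at this
    have := (this (by omega) (by omega) (by omega) (by omega)).2 (by decide)
    simp at this
    simp [layer]
    linarith

/-- To establish `R(d)` on `S` it suffices to treat one rhombus `u, u + d, u + a, u + d - a` with
short diagonal `d` at each place, where `a, d - a ∈ ±D`. -/
theorem faceR_of_short {S : Set V3} {F : V3 → ℝ} {d : V3}
    (h : ∀ u a, a ∈ pmD → d - a ∈ pmD → a ≠ d - a → u ∈ S → u + d ∈ S → u + a ∈ S →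
      u + d - a ∈ S → F (u + a) + F (u + d - a) ≤ F u + F (u + d)) : FaceR S F d := by
  have hneg : ∀ {v : V3}, v ∈ pmD → -v ∈ pmD := by
    intro v hv
    rcases hv with hv | hv
    · exact Or.inr (by rwa [neg_neg])
    · exact Or.inl hv
  intro q a b ⟨ha, hb, hab, hab', _⟩ h0 h1 h2 h3
  refine ⟨?_, ?_⟩
  · rintro (e | e)
    · obtain rfl : b = d - a := by rw [← e]; abel
      have := h q a ha hb hab h0 (by convert h3 using 1; abel) h1 (by convert h2 using 1; abel)
      convert this using 3 <;> abel
    · obtain rfl : d = -a - b := by rw [← neg_eq_iff_eq_neg.mpr e]; abel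
      have := h (q + a + b) (-a) (hneg ha) (by convert hneg hb using 1; abel)
        (by intro e; apply hab; rw [← neg_inj, e]; abel) h3
        (by convert h0 using 1; abel) (by convert h2 using 1; abel) (by convert h1 using 1; abel)
      rw [ge_iff_le, add_comm (F (q + a)), add_comm (F q)]
      convert this using 3 <;> abel
  · rintro (e | e)
    · obtain rfl : a = d + b := by rw [← e]; abel
      have := h (q + b) (-b) (hneg hb) (by convert ha using 1; abel)
        (by intro e; apply hab'; rw [e]; abel) h2
        (by convert h1 using 1; abel) (by convert h0 using 1; abel) (by convert h3 using 1; abel)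
      rw [ge_iff_le, add_comm (F (q + (d + b)))]
      convert this using 3 <;> abel
    · obtain rfl : b = d + a := by rw [← neg_eq_iff_eq_neg.mpr e]; abel
      have := h (q + a) (-a) (hneg ha) (by convert hb using 1; abel)
        (by intro e; apply hab'; rw [← neg_inj, e]; abel) h1
        (by convert h2 using 1; abel) (by convert h0 using 1; abel) (by convert h3 using 1; abel)
      rw [ge_iff_le]
      convert this using 3 <;> abel

theorem faceR_shadow_e3 {n : ℕ} {F : V3 → ℝ}
    (h : ∀ y k, y + k + 2 ≤ n → layer F k 0 (y + 2) + layer F (k + 1) 0 y ≤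
      layer F k 0 (y + 1) + layer F (k + 1) 0 (y + 1)) :
    FaceR (shadowWall n) F e3 := by
  have hF : ∀ y z : ℤ, 1 ≤ y → 0 ≤ z → y + z + 1 ≤ n →
      F (0, y + 1, z) + F (0, y + -1, z + 1) ≤ F (0, y, z) + F (0, y, z + 1) := by
    intro y z hy hz hn
    obtain ⟨y, rfl⟩ : ∃ j : ℕ, y = j + 1 := ⟨(y - 1).toNat, by omega⟩
    lift z to ℕ using hz
    simpa [layer, add_assoc] using h y z (by omega)
  apply faceR_of_short
  rintro ⟨x, y, z⟩ a ha
  rcases (mem_pmD_iff a).1 ha with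
    rfl | rfl | rfl | rfl | rfl | rfl | rfl | rfl | rfl | rfl | rfl | rfl <;>
  simp [e3, mem_pmD_iff, mem_shadowWall_mk, mem_Tet_mk, sub_eq_add_neg] <;>
  intros <;>
  first
  | omega
  | linarith
  | obtain rfl : x = 0 := by assumption
    linarith [hF y z (by omega) (by omega) (by omega)]

theorem faceR_shadow_e2_sub_e3 {n : ℕ} {F : V3 → ℝ}
    (h : ∀ y k, y + k + 2 ≤ n → layer F k 0 y + layer F (k + 1) 0 (y + 1) ≤
      layer F k 0 (y + 1) + layer F (k + 1) 0 y) :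
    FaceR (shadowWall n) F (e2 - e3) := by
  have hF : ∀ y z : ℤ, 0 ≤ y → 1 ≤ z → y + z + 1 ≤ n →
      F (0, y, z + -1) + F (0, y + 1, z) ≤ F (0, y + 1, z + -1) + F (0, y, z) := by
    intro y z hy hz hn
    lift y to ℕ using hy
    obtain ⟨z, rfl⟩ : ∃ j : ℕ, z = j + 1 := ⟨(z - 1).toNat, by omega⟩
    simpa [layer, add_assoc] using h y z (by omega)
  apply faceR_of_short
  rintro ⟨x, y, z⟩ a ha
  rcases (mem_pmD_iff a).1 ha with
    rfl | rfl | rfl | rfl | rfl | rfl | rfl | rfl | rfl | rfl | rfl | rfl <;>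
  simp [e2, e3, mem_pmD_iff, mem_shadowWall_mk, mem_Tet_mk, sub_eq_add_neg] <;>
  intros <;>
  first
  | omega
  | linarith
  | obtain rfl : x = 0 := by assumption
    linarith [hF y z (by omega) (by omega) (by omega)]

theorem faceR_slope_e1_sub_e3 {n : ℕ} {F : V3 → ℝ}
    (h : ∀ x y k, x + y + k + 2 = n → layer F (k + 1) (x + 1) y + layer F k x (y + 2) ≤
      layer F (k + 1) x (y + 1) + layer F k (x + 1) (y + 1)) :
    FaceR (slopeWall n) F (e1 - e3) := by
  have hF : ∀ x y z : ℤ, 0 ≤ x → 1 ≤ y → 1 ≤ z → x + y + z = n →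
      F (x + 1, y + -1, z) + F (x, y + 1, z + -1) ≤ F (x, y, z) + F (x + 1, y, z + -1) := by
    intro x y z hx hy hz hn
    lift x to ℕ using hx
    obtain ⟨y, rfl⟩ : ∃ j : ℕ, y = j + 1 := ⟨(y - 1).toNat, by omega⟩
    obtain ⟨z, rfl⟩ : ∃ j : ℕ, z = j + 1 := ⟨(z - 1).toNat, by omega⟩
    simpa [layer, add_assoc] using h x y z (by omega)
  apply faceR_of_short
  rintro ⟨x, y, z⟩ a ha
  rcases (mem_pmD_iff a).1 ha with
    rfl | rfl | rfl | rfl | rfl | rfl | rfl | rfl | rfl | rfl | rfl | rfl <;>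
  simp [e1, e3, mem_pmD_iff, mem_slopeWall_mk, mem_Tet_mk, sub_eq_add_neg] <;>
  intros <;>
  first
  | omega
  | linarith
  | linarith [hF x y z (by omega) (by omega) (by omega) (by omega)]

theorem faceR_slope_e2_sub_e3 {n : ℕ} {F : V3 → ℝ}
    (h : ∀ x y k, x + y + k + 2 = n → layer F (k + 1) x (y + 1) + layer F k (x + 2) y ≤
      layer F (k + 1) (x + 1) y + layer F k (x + 1) (y + 1)) :
    FaceR (slopeWall n) F (e2 - e3) := by
  have hF : ∀ x y z : ℤ, 1 ≤ x → 0 ≤ y → 1 ≤ z → x + y + z = n →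
      F (x + -1, y + 1, z) + F (x + 1, y, z + -1) ≤ F (x, y, z) + F (x, y + 1, z + -1) := by
    intro x y z hx hy hz hn
    obtain ⟨x, rfl⟩ : ∃ j : ℕ, x = j + 1 := ⟨(x - 1).toNat, by omega⟩
    lift y to ℕ using hy
    obtain ⟨z, rfl⟩ : ∃ j : ℕ, z = j + 1 := ⟨(z - 1).toNat, by omega⟩
    simpa [layer, add_assoc] using h x y z (by omega)
  apply faceR_of_short
  rintro ⟨x, y, z⟩ a ha
  rcases (mem_pmD_iff a).1 ha with
    rfl | rfl | rfl | rfl | rfl | rfl | rfl | rfl | rfl | rfl | rfl | rfl <;>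
  simp [e2, e3, mem_pmD_iff, mem_slopeWall_mk, mem_Tet_mk, sub_eq_add_neg] <;>
  intros <;>
  first
  | omega
  | linarith
  | linarith [hF x y z (by omega) (by omega) (by omega) (by omega)]

/-- if a polarized function on `Δ_n(OXYZ)` is discrete concave on the ground and
HS-concave (strip-concave along `e₁`, i.e. `R(e₃)` and `R(e₁−e₃)` hold) on the front wall,
then it is HS-concave on the shadow wall (strip-concave along `e₂`: `R(e₃)` and `R(e₂−e₃)`)
and on the slope wall (strip-concave along `e₁−e₂`: `R(e₁−e₃)` and `R(e₂−e₃)`). -/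
theorem tet_hs_concavity_propagates (n : ℕ) (F : V3 → ℝ)
    (hpol : IsPolarizedOn (Tet n) F)
    (hground : DiscreteConcaveOn (ground n) F)
    (hfront₁ : FaceR (frontWall n) F e3)
    (hfront₂ : FaceR (frontWall n) F (e1 - e3)) :
    (FaceR (shadowWall n) F e3 ∧ FaceR (shadowWall n) F (e2 - e3)) ∧
      (FaceR (slopeWall n) F (e1 - e3) ∧ FaceR (slopeWall n) F (e2 - e3)) := by
  have hconc : ∀ k m, k + m = n → TriConcave m (layer F k) := by
    intro k
    induction k with
    | zero =>
      intro m hm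
      obtain rfl : m = n := by omega
      exact .of_ground hground
    | succ k ih =>
      intro m hm
      have hf := ih (m + 1) (by omega)
      have hrec := hpol.octRec hm
      exact hf.of_octRec hrec (.of_zero hf hrec (.of_frontWall hfront₁ hfront₂ hm))
  have hslab : ∀ k m, k + 1 + m = n → TriConcave (m + 1) (layer F k) ∧
      OctRec m (layer F k) (layer F (k + 1)) ∧
      ∀ y, RowInterlace m (layer F k) (layer F (k + 1)) y := fun k m hm =>
    have hf := hconc k (m + 1) (by omega)
    have hrec := hpol.octRec hm
    ⟨hf, hrec, .of_zero hf hrec (.of_frontWall hfront₁ hfront₂ hm)⟩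
  refine ⟨⟨faceR_shadow_e3 ?_, faceR_shadow_e2_sub_e3 ?_⟩,
    faceR_slope_e1_sub_e3 ?_, faceR_slope_e2_sub_e3 ?_⟩
  · intro y k hk
    obtain ⟨hf, hrec, -⟩ := hslab k (n - (k + 1)) (by omega)
    exact hrec.short_e3_shadow hf (by omega)
  · intro y k hk
    obtain ⟨hf, hrec, hi⟩ := hslab k (n - (k + 1)) (by omega)
    exact hrec.short_e2_sub_e3_shadow hf (hi y) (by omega)
  · intro x y k hk
    obtain ⟨hf, hrec, -⟩ := hslab k (n - (k + 1)) (by omega)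
    exact hrec.short_e1_sub_e3_slope hf (by omega)
  · intro x y k hk
    obtain ⟨hf, hrec, hi⟩ := hslab k (n - (k + 1)) (by omega)
    exact hrec.short_e2_sub_e3_slope hf (hi y) (by omega)
end
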